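/- Assume τ_n^{s,t+1} ≠ 0, τ_{n−1}^{s,t+1} ≠ 0, σ_{n−1}^{s,t} ≠ 0 and σ_n^{s,t} ≠ 0. Then for every n ≥ 1 the polynomial identity P_n^{s,t+1}(x) = R_n^{s,t}(x) − d_n^{s,t} P_{n−1}^{s,t+1}(x) holds, where d_n^{s,t} = −σ_n^{s,t}τ_{n−1}^{s,t+1}/(σ_{n−1}^{s,t}τ_n^{s,t+1}). -/

import Mathlib

open MeasureTheory

/-- Bimoments `m_{i,j}^{s,t}` of the Cauchy-Jacobi weight. -/
noncomputable def mom (s t i j : ℕ) : ℝ :=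
  ∫ p in (Set.Ioo (0:ℝ) 1 ×ˢ Set.Ioo (0:ℝ) 1),
    (p.1 ^ (s + i) * p.2 ^ (s + j) / (p.1 + p.2)) *
      ((1 - p.1) / (1 + p.1)) ^ t * ((1 - p.2) / (1 + p.2)) ^ t

/-- Single moments `φ_i^{s,t} = L_{s,t}(x^i)`. -/
noncomputable def phi (s t i : ℕ) : ℝ :=
  Real.sqrt 2 * ∫ x in Set.Ioo (0:ℝ) 1,
    (x ^ (s + i) / (1 + x)) * ((1 - x) / (1 + x)) ^ t

/-- Single moments `m_i^{s,t}`. -/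
noncomputable def momS (s t i : ℕ) : ℝ :=
  ∫ x in Set.Ioo (0:ℝ) 1, x ^ (s + i) * ((1 - x) / (1 + x)) ^ t

/-- `τ_n^{s,t} = det(m_{i,j}^{s,t})_{i,j=0}^{n-1}` (with `τ_0^{s,t} = 1`). -/
noncomputable def tau (s t n : ℕ) : ℝ :=
  Matrix.det (Matrix.of fun i j : Fin n => mom s t i j)

/-- `ξ_n^{s,t} = det(m_{i,j+1}^{s,t})_{i,j=0}^{n-1}` (with `ξ_0^{s,t} = 1`). -/
noncomputable def xi (s t n : ℕ) : ℝ :=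
  Matrix.det (Matrix.of fun i j : Fin n => mom s t i ((j : ℕ) + 1))

/-- `σ_n^{s,t}`: determinant of the `(n+1)×(n+1)` matrix with first `n` columns the
bimoments and last column `(φ_0^{s,t},…,φ_n^{s,t})`. -/
noncomputable def sig (s t n : ℕ) : ℝ :=
  Matrix.det (Matrix.of fun i j : Fin (n + 1) =>
    if (j : ℕ) < n then mom s t i j else phi s t i)

/-- `ψ_n^{s,t}`: like `σ_n^{s,t}` but with shifted bimoments `m_{i,j+1}^{s,t}`. -/
noncomputable def psi (s t n : ℕ) : ℝ :=
  Matrix.det (Matrix.of fun i j : Fin (n + 1) =>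
    if (j : ℕ) < n then mom s t i ((j : ℕ) + 1) else phi s t i)

/-- `σ̃_n^{s,t}`: determinant of the `(n+1)×(n+1)` matrix with first `n` columns the
bimoments and last column the single moments `(m_0^{s,t},…,m_n^{s,t})`. -/
noncomputable def sigT (s t n : ℕ) : ℝ :=
  Matrix.det (Matrix.of fun i j : Fin (n + 1) =>
    if (j : ℕ) < n then mom s t i j else momS s t i)

/-- `τ̃_n^{s,t}`: determinant of the `n×n` matrix whose rows are the bimoment rows
`i = 0,…,n−2,n`. -/
noncomputable def tauT (s t n : ℕ) : ℝ :=
  Matrix.det (Matrix.of fun i j : Fin n =>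
    mom s t (if (i : ℕ) < n - 1 then (i : ℕ) else n) j)

/-- The monic Cauchy-Jacobi orthogonal polynomial `P_n^{s,t}` (as a real function). -/
noncomputable def P (s t n : ℕ) (x : ℝ) : ℝ :=
  (1 / tau s t n) * Matrix.det (Matrix.of fun i j : Fin (n + 1) =>
    if (j : ℕ) < n then mom s t i j else x ^ (i : ℕ))

/-- The adjacent monic polynomial `Q_n^{s,t}` (as a real function). -/
noncomputable def Q (s t n : ℕ) (x : ℝ) : ℝ :=
  (1 / xi s t n) * Matrix.det (Matrix.of fun i j : Fin (n + 1) =>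
    if (j : ℕ) < n then mom s t i ((j : ℕ) + 1) else x ^ (i : ℕ))

/-- The auxiliary monic polynomial `R_n^{s,t}` (as a real function): first column
`(φ_0,…,φ_n)`, next `n−1` columns the bimoments `m_{i,j}` for `j = 0,…,n−2`,
last column `(1,x,…,x^n)`, normalized by `(−1)^{n−1}/σ_{n−1}^{s,t}`. -/
noncomputable def R (s t n : ℕ) (x : ℝ) : ℝ :=
  ((-1 : ℝ) ^ (n - 1) / sig s t (n - 1)) *
    Matrix.det (Matrix.of fun i j : Fin (n + 1) =>
      if (j : ℕ) = 0 then phi s t i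
      else if (j : ℕ) < n then mom s t i ((j : ℕ) - 1) else x ^ (i : ℕ))

/-- The two-parameter deformed Cauchy inner product `⟨f,g⟩_{s,t}` on real functions. -/
noncomputable def innerF (s t : ℕ) (f g : ℝ → ℝ) : ℝ :=
  ∫ p in (Set.Ioo (0:ℝ) 1 ×ˢ Set.Ioo (0:ℝ) 1),
    (p.1 ^ s * p.2 ^ s / (p.1 + p.2)) * f p.1 * g p.2 *
      ((1 - p.1) / (1 + p.1)) ^ t * ((1 - p.2) / (1 + p.2)) ^ t

/-- The two-parameter deformed Cauchy inner product on real polynomials. -/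
noncomputable def innerP (s t : ℕ) (f g : Polynomial ℝ) : ℝ :=
  innerF s t (fun x => f.eval x) (fun y => g.eval y)

/-- The linear functional `L_{s,t}` on real functions. -/
noncomputable def LF (s t : ℕ) (f : ℝ → ℝ) : ℝ :=
  Real.sqrt 2 * ∫ x in Set.Ioo (0:ℝ) 1,
    (x ^ s / (1 + x)) * f x * ((1 - x) / (1 + x)) ^ t

/-- The linear functional `L_{s,t}` on real polynomials. -/
noncomputable def LP (s t : ℕ) (f : Polynomial ℝ) : ℝ := LF s t (fun x => f.eval x)

/-- The integrand of `mom` is integrable: on the unit square it is dominated by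
`x ^ (-1/2) * y ^ (-1/2)`. -/
theorem integrableOn_mom (s t i j : ℕ) :
    IntegrableOn (fun p : ℝ × ℝ => (p.1 ^ (s + i) * p.2 ^ (s + j) / (p.1 + p.2)) *
      ((1 - p.1) / (1 + p.1)) ^ t * ((1 - p.2) / (1 + p.2)) ^ t)
      (Set.Ioo (0:ℝ) 1 ×ˢ Set.Ioo (0:ℝ) 1) := by
  have h₁ : Integrable (fun x : ℝ => x ^ (-(1 / 2) : ℝ))
      (volume.restrict (Set.Ioo (0:ℝ) 1)) := by
    have := (intervalIntegral.intervalIntegrable_rpow' (a := 0) (b := 1)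
      (r := (-(1 / 2) : ℝ)) (by norm_num)).1
    exact this.mono_set Set.Ioo_subset_Ioc_self
  have h₂ := h₁.mul_prod h₁
  rw [Measure.prod_restrict, ← Measure.volume_eq_prod] at h₂
  refine Integrable.mono' h₂ (Measurable.aestronglyMeasurable (by fun_prop)) ?_
  refine (ae_restrict_iff' (measurableSet_Ioo.prod measurableSet_Ioo)).2 (.of_forall ?_)
  rintro ⟨x, y⟩ ⟨⟨hx0, hx1⟩, hy0, hy1⟩
  dsimp only at hx0 hx1 hy0 hy1 ⊢
  have weight_nonneg : ∀ z : ℝ, 0 < z → z < 1 → 0 ≤ (1 - z) / (1 + z) := fun z h0 h1 =>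
    div_nonneg (by linarith) (by linarith)
  have weight_le_one : ∀ z : ℝ, 0 < z → z < 1 → (1 - z) / (1 + z) ≤ 1 := fun z h0 h1 =>
    (div_le_one (by linarith)).2 (by linarith)
  have hwx := weight_nonneg x hx0 hx1
  have hwy := weight_nonneg y hy0 hy1
  have hinv : 1 / (x + y) ≤ x ^ (-(1 / 2) : ℝ) * y ^ (-(1 / 2) : ℝ) := by
    rw [Real.rpow_neg hx0.le, Real.rpow_neg hy0.le, ← Real.sqrt_eq_rpow,
      ← Real.sqrt_eq_rpow, ← mul_inv, one_div]
    have hx := Real.sqrt_pos.2 hx0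
    have hy := Real.sqrt_pos.2 hy0
    refine inv_anti₀ (mul_pos hx hy) ?_
    nlinarith [Real.sq_sqrt hx0.le, Real.sq_sqrt hy0.le, sq_nonneg (√x - √y)]
  have hxy : 0 < x + y := by linarith
  rw [Real.norm_of_nonneg (by positivity)]
  have hnum : x ^ (s + i) * y ^ (s + j) ≤ 1 :=
    mul_le_one₀ (pow_le_one₀ hx0.le hx1.le) (by positivity) (pow_le_one₀ hy0.le hy1.le)
  have hx := pow_le_one₀ (n := t) hwx (weight_le_one x hx0 hx1)
  have hy := pow_le_one₀ (n := t) hwy (weight_le_one y hy0 hy1)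
  calc _ ≤ x ^ (s + i) * y ^ (s + j) / (x + y) :=
        (mul_le_of_le_one_right (by positivity) hy).trans
          (mul_le_of_le_one_right (by positivity) hx)
    _ ≤ 1 / (x + y) := by gcongr
    _ ≤ _ := hinv

/-- Raising `t` by one is a rank-one perturbation of the bimoments. -/
theorem mom_succ (s t i j : ℕ) :
    mom s (t + 1) i j = mom s t i j - phi s t i * phi s t j := by
  have hphi : phi s t i * phi s t j =
      ∫ p in (Set.Ioo (0:ℝ) 1 ×ˢ Set.Ioo (0:ℝ) 1),
        2 * (((p.1 ^ (s + i) / (1 + p.1)) * ((1 - p.1) / (1 + p.1)) ^ t) *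
          ((p.2 ^ (s + j) / (1 + p.2)) * ((1 - p.2) / (1 + p.2)) ^ t)) := by
    rw [integral_const_mul, Measure.volume_eq_prod,
      setIntegral_prod_mul (fun x : ℝ => (x ^ (s + i) / (1 + x)) * ((1 - x) / (1 + x)) ^ t)
        (fun x : ℝ => (x ^ (s + j) / (1 + x)) * ((1 - x) / (1 + x)) ^ t), phi, phi,
      mul_mul_mul_comm, Real.mul_self_sqrt zero_le_two]
  rw [eq_sub_iff_add_eq', ← eq_sub_iff_add_eq, hphi, mom, mom,
    ← integral_sub (integrableOn_mom s t i j) (integrableOn_mom s (t + 1) i j)]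
  refine setIntegral_congr_fun (measurableSet_Ioo.prod measurableSet_Ioo) ?_
  rintro ⟨x, y⟩ ⟨⟨hx0, hx1⟩, hy0, hy1⟩
  dsimp only at hx0 hx1 hy0 hy1 ⊢
  have hx : 1 + x ≠ 0 := by positivity
  have hy : 1 + y ≠ 0 := by positivity
  have hxy : x + y ≠ 0 := by positivity
  rw [pow_succ, pow_succ]
  generalize hu : ((1 - x) / (1 + x)) ^ t = u
  generalize hv : ((1 - y) / (1 + y)) ^ t = v
  field_simp
  ring

namespace Matrix

variable {ι A : Type*} [Fintype ι] [DecidableEq ι] [CommRing A]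

/-- The three-term Plücker relation. -/
theorem det_mul_det_updateCol_updateCol (M : Matrix ι ι A) {i j : ι} (hij : i ≠ j)
    (u v : ι → A) :
    M.det * ((M.updateCol i u).updateCol j v).det =
      (M.updateCol i u).det * (M.updateCol j v).det -
        (M.updateCol j u).det * (M.updateCol i v).det := by
  have hu : M.det • u = ∑ k, cramer M u k • M.col k := by
    rw [← mulVec_cramer]
    ext l
    simp [mulVec, dotProduct, mul_comm]
  have key : ∀ w, ((M.updateCol i w).updateCol j v).det =
      cramer (M.updateCol j v) w i := fun w => by
    rw [cramer_apply, updateCol_comm _ hij]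
  have hcol : ∀ k, k ≠ i → k ≠ j → cramer (M.updateCol j v) (M.col k) i = 0 := by
    intro k hi hj
    rw [cramer_apply]
    refine det_zero_of_column_eq hi (fun l => ?_)
    simp [hi, hj]
  have hi : cramer (M.updateCol j v) (M.col i) i = (M.updateCol j v).det := by
    rw [cramer_apply]
    congr 1
    ext k l
    by_cases h : l = i
    · subst h
      simp [hij]
    · simp [h]
  have hj : cramer (M.updateCol j v) (M.col j) i = -(M.updateCol i v).det := by
    have hswap : (M.updateCol j v).updateCol i (M.col j) =
        (M.updateCol i v).submatrix id (Equiv.swap i j) := by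
      ext k l
      rcases eq_or_ne l i with rfl | hli
      · simp [hij.symm]
      · rcases eq_or_ne l j with rfl | hlj
        · simp [hli]
        · simp [hli, hlj, Equiv.swap_apply_of_ne_of_ne hli hlj]
    rw [cramer_apply, hswap, det_permute', Equiv.Perm.sign_swap hij]
    simp
  rw [key, ← smul_eq_mul, ← Pi.smul_apply, ← map_smul, hu, map_sum, Finset.sum_apply,
    ← Finset.sum_subset (Finset.subset_univ {i, j}), Finset.sum_pair hij]
  · simp only [map_smul, Pi.smul_apply, hi, hj, smul_eq_mul]
    rw [cramer_apply, cramer_apply]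
    ring
  · intro k _ hk
    simp only [Finset.mem_insert, Finset.mem_singleton, not_or] at hk
    simp [hcol k hk.1 hk.2]

/-- Adding multiples of one column to the other columns does not change the determinant. -/
theorem det_eq_of_forall_col_eq_add_mul {M N : Matrix ι ι A} (c : ι → A) (k : ι)
    (hk : c k = 0) (h : ∀ i j, M i j = N i j + c j * N i k) : M.det = N.det := by
  rw [← det_transpose M, ← det_transpose N]
  exact det_eq_of_forall_row_eq_smul_add_const c k hk fun i j => h j i

/-- A determinant whose last column is the last basis vector is a principal minor. -/
theorem det_eq_det_submatrix_castSucc {n : ℕ} (M : Matrix (Fin (n + 1)) (Fin (n + 1)) A)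
    (hlast : M (Fin.last n) (Fin.last n) = 1) (h : ∀ i : Fin n, M i.castSucc (Fin.last n) = 0) :
    M.det = (M.submatrix Fin.castSucc Fin.castSucc).det := by
  rw [det_succ_column M (Fin.last n), Fin.sum_univ_castSucc]
  simp [h, hlast, Even.neg_one_pow (Even.add_self n)]

end Matrix

/-- In `sig s t n` the bimoments may be replaced by those with `t + 1`. -/
theorem sig_eq_det_mom_succ (s t n : ℕ) :
    sig s t n = Matrix.det (Matrix.of fun i j : Fin (n + 1) =>
      if (j : ℕ) < n then mom s (t + 1) i j else phi s t i) := by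
  refine Matrix.det_eq_of_forall_col_eq_add_mul
    (fun j => if (j : ℕ) < n then phi s t j else 0) (Fin.last n) (by simp) fun i j => ?_
  by_cases h : (j : ℕ) < n
  · simp [h, mom_succ, mul_comm]
  · simp [h]

/-- `R` in terms of the bimoments with `t + 1`, with the column of single moments moved next to
the last one. -/
theorem R_succ_eq (s t k : ℕ) (x : ℝ) :
    R s t (k + 1) x = 1 / sig s t k * Matrix.det (Matrix.of fun i j : Fin (k + 2) =>
      if (j : ℕ) < k then mom s (t + 1) i j
      else if (j : ℕ) < k + 1 then phi s t i else x ^ (i : ℕ)) := by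
  set c : Fin (k + 2) := (Fin.last k).castSucc
  set N : Matrix (Fin (k + 2)) (Fin (k + 2)) ℝ := Matrix.of fun i j =>
    if (j : ℕ) = 0 then phi s t i
    else if (j : ℕ) < k + 1 then mom s t i ((j : ℕ) - 1) else x ^ (i : ℕ) with hN
  have hdet : Matrix.det (Matrix.of fun i j : Fin (k + 2) =>
      if (j : ℕ) < k then mom s (t + 1) i j
      else if (j : ℕ) < k + 1 then phi s t i else x ^ (i : ℕ)) = (-1) ^ k * N.det := by
    have hperm := Matrix.det_permute' c.cycleRange N
    rw [Fin.sign_cycleRange] at hperm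
    have hck : (c : ℕ) = k := rfl
    rw [hck] at hperm
    push_cast at hperm
    rw [← hperm]
    refine Matrix.det_eq_of_forall_col_eq_add_mul
      (fun j => if (j : ℕ) < k then -phi s t j else 0) c (by simp [hck]) fun i j => ?_
    rcases lt_trichotomy (j : ℕ) k with h | h | h
    · have hj : ((c.cycleRange j : Fin (k + 2)) : ℕ) = j + 1 :=
        Fin.coe_cycleRange_of_lt (Fin.lt_def.2 h)
      have h0 : c.cycleRange j ≠ 0 := by
        rw [Ne, Fin.ext_iff, hj]
        simp
      simp [hN, h, hj, h0, mom_succ]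
      ring
    · obtain rfl : j = c := Fin.ext h
      simp [hN, hck]
    · have hj : c.cycleRange j = j := Fin.cycleRange_of_gt (Fin.lt_def.2 h)
      have h1 : ¬ (j : ℕ) < k := by omega
      have h2 : ¬ (j : ℕ) < k + 1 := by omega
      have h3 : j ≠ 0 := by
        rintro rfl
        simp at h
      simp only [hN, hj, h1, h2, Matrix.of_apply, Matrix.submatrix_apply, id, Fin.val_eq_zero_iff,
        h3, if_false]
      simp
  rw [hdet, R, Nat.add_sub_cancel]
  ring

/-- the discrete transformation
`P_n^{s,t+1} = R_n^{s,t} − d_n^{s,t}P_{n−1}^{s,t+1}` with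
`d_n^{s,t} = −σ_n^{s,t}τ_{n−1}^{s,t+1}/(σ_{n−1}^{s,t}τ_n^{s,t+1})`. -/
theorem R_transformation (s t n : ℕ) (hn : 1 ≤ n)
    (h₁ : tau s (t + 1) n ≠ 0) (h₂ : tau s (t + 1) (n - 1) ≠ 0)
    (h₃ : sig s t (n - 1) ≠ 0) (h₄ : sig s t n ≠ 0) (x : ℝ) :
    P s (t + 1) n x =
      R s t n x -
        (-(sig s t n * tau s (t + 1) (n - 1)) / (sig s t (n - 1) * tau s (t + 1) n)) *
          P s (t + 1) (n - 1) x := by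
  obtain ⟨k, rfl⟩ : ∃ k, n = k + 1 := ⟨n - 1, by omega⟩
  rw [Nat.add_sub_cancel] at *
  set M : Matrix (Fin (k + 2)) (Fin (k + 2)) ℝ := Matrix.of fun i j =>
    if (j : ℕ) < k + 1 then mom s (t + 1) i j else if (i : ℕ) = k + 1 then 1 else 0 with hM
  set a : Fin (k + 2) := (Fin.last k).castSucc with ha
  set b : Fin (k + 2) := Fin.last (k + 1) with hb
  have hab : a ≠ b := (Fin.castSucc_lt_last _).ne
  have update_last : ∀ u : ℕ → ℝ, M.updateCol b (fun i => u i) =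
      Matrix.of fun i j : Fin (k + 2) => if (j : ℕ) < k + 1 then mom s (t + 1) i j else u i := by
    intro u
    ext i j
    refine Fin.lastCases ?_ (fun j => ?_) j
    · simp [hb]
    · simp [hb, hM, Fin.castSucc_ne_last, Nat.le_of_lt_succ j.2]
  have update_castSucc : ∀ u : ℕ → ℝ, (M.updateCol a (fun i => u i)).det =
      Matrix.det (Matrix.of fun i j : Fin (k + 1) =>
        if (j : ℕ) < k then mom s (t + 1) i j else u i) := by
    intro u
    rw [Matrix.det_eq_det_submatrix_castSucc]
    · congr 1
      ext i j
      refine Fin.lastCases ?_ (fun j => ?_) j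
      · simp [ha]
      · simp [ha, hM, Fin.ext_iff, j.2.ne]
    · simp [hM, ha, Fin.ext_iff]
    · intro i
      simp [hM, ha, Fin.ext_iff, i.2.ne]
  have hdet : M.det = tau s (t + 1) (k + 1) := by
    rw [Matrix.det_eq_det_submatrix_castSucc, tau]
    · congr 1
      ext i j
      simp [hM, Nat.le_of_lt_succ j.2]
    · simp [hM]
    · intro i
      simp [hM, i.2.ne]
  have hboth : (M.updateCol a (fun i => phi s t i)).updateCol b (fun i => x ^ (i : ℕ)) =
      Matrix.of fun i j : Fin (k + 2) => if (j : ℕ) < k then mom s (t + 1) i j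
        else if (j : ℕ) < k + 1 then phi s t i else x ^ (i : ℕ) := by
    ext i j
    simp only [hM, ha, hb, Matrix.updateCol_apply, Matrix.of_apply, Fin.ext_iff, Fin.val_last,
      Fin.val_castSucc]
    split_ifs <;> first | rfl | omega
  have plucker := M.det_mul_det_updateCol_updateCol hab (fun i => phi s t i)
    (fun i => x ^ (i : ℕ))
  rw [hdet, hboth, update_last (phi s t), update_last (fun i => x ^ i),
    update_castSucc (phi s t), update_castSucc (fun i => x ^ i), ← sig_eq_det_mom_succ,
    ← sig_eq_det_mom_succ] at plucker
  rw [R_succ_eq, P, P]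
  field_simp
  linear_combination -plucker
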